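/- arXiv:2412.18297 — 2 statements merged into one kernel-verified Lean document; each statement's English description precedes it below -/
import Mathlib

section
/- The valid candidate set S = {Φ ∈ (Δ_{mn})^k : C(Φ) is response-satisfiable} is a convex subset of (Δ_{mn})^k. That is, if Φ₁ = (φ_{1,1},…,φ_{1,k}) and Φ₂ = (φ_{2,1},…,φ_{2,k}) are CSP assignments such that both C(Φ₁) and C(Φ₂) are response-satisfiable, then for every λ ∈ [0,1] the assignment Φ' = λΦ₁ + (1−λ)Φ₂ (componentwise convex combination) has C(Φ') response-satisfiable. -/
open scoped BigOperators

noncomputable section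

/-- Linear extension of a payoff function `u : [m]×[n] → ℝ` to CSPs:
`u(φ) = Σ_{i,j} φ(i,j) u(i,j)`. -/
def lin {m n : ℕ} (u : Fin m × Fin n → ℝ) (φ : Fin m × Fin n → ℝ) : ℝ :=
  ∑ p : Fin m × Fin n, φ p * u p

/-- The product distribution `x ⊗ y`. -/
def prodCSP {m n : ℕ} (x : Fin m → ℝ) (y : Fin n → ℝ) : Fin m × Fin n → ℝ :=
  fun p => x p.1 * y p.2

/-- A set of CSPs is response-satisfiable if for every mixed strategy `y` of the
optimizer there is a mixed strategy `x` of the learner with `x ⊗ y` in the set. -/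
def ResponseSatisfiable {m n : ℕ} (M : Set (Fin m × Fin n → ℝ)) : Prop :=
  ∀ y ∈ stdSimplex ℝ (Fin n), ∃ x ∈ stdSimplex ℝ (Fin m), prodCSP x y ∈ M

/-- The candidate menu `C(Φ, ε)` of a CSP assignment `Φ`. -/
def candidateMenu {m n k : ℕ} (uO : Fin k → Fin m × Fin n → ℝ)
    (Φ : Fin k → Fin m × Fin n → ℝ) (ε : ℝ) : Set (Fin m × Fin n → ℝ) :=
  {φ ∈ stdSimplex ℝ (Fin m × Fin n) | ∀ i, lin (uO i) φ ≤ lin (uO i) (Φ i) + ε}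

theorem lin_combo {m n : ℕ} (u φ ψ : Fin m × Fin n → ℝ) (a b : ℝ) :
    lin u (a • φ + b • ψ) = a * lin u φ + b * lin u ψ := by
  simp only [lin, Pi.add_apply, Pi.smul_apply, smul_eq_mul, Finset.mul_sum,
    ← Finset.sum_add_distrib]
  exact Finset.sum_congr rfl fun p _ => by ring

theorem prodCSP_combo {m n : ℕ} (x x' : Fin m → ℝ) (y : Fin n → ℝ) (a b : ℝ) :
    prodCSP (a • x + b • x') y = a • prodCSP x y + b • prodCSP x' y := by
  ext p
  simp only [prodCSP, Pi.add_apply, Pi.smul_apply, smul_eq_mul]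
  ring

/-- the valid candidate set
`S = {Φ ∈ (Δ_{mn})^k : C(Φ) is response-satisfiable}` is convex: componentwise
convex combinations of members of `S` belong to `S`. -/
theorem validCandidateSet_convex {m n k : ℕ} (hm : 0 < m) (hn : 0 < n) (hk : 0 < k)
    (uO : Fin k → Fin m × Fin n → ℝ)
    (Φ₁ Φ₂ : Fin k → Fin m × Fin n → ℝ)
    (hΦ₁ : ∀ i, Φ₁ i ∈ stdSimplex ℝ (Fin m × Fin n))
    (hΦ₂ : ∀ i, Φ₂ i ∈ stdSimplex ℝ (Fin m × Fin n))
    (h₁ : ResponseSatisfiable (candidateMenu uO Φ₁ 0))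
    (h₂ : ResponseSatisfiable (candidateMenu uO Φ₂ 0))
    (lam : ℝ) (hlam₀ : 0 ≤ lam) (hlam₁ : lam ≤ 1) :
    ResponseSatisfiable
      (candidateMenu uO (fun i => lam • Φ₁ i + (1 - lam) • Φ₂ i) 0) := by
  intro y hy
  obtain ⟨x₁, hx₁, hmem₁, hle₁⟩ := h₁ y hy
  obtain ⟨x₂, hx₂, hmem₂, hle₂⟩ := h₂ y hy
  have hμ : 0 ≤ 1 - lam := sub_nonneg.mpr hlam₁
  have hsum : lam + (1 - lam) = 1 := by ring
  refine ⟨lam • x₁ + (1 - lam) • x₂, convex_stdSimplex ℝ _ hx₁ hx₂ hlam₀ hμ hsum, ?_⟩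
  rw [prodCSP_combo]
  refine ⟨convex_stdSimplex ℝ _ hmem₁ hmem₂ hlam₀ hμ hsum, fun i => ?_⟩
  rw [lin_combo, lin_combo, add_zero]
  exact add_le_add
    (mul_le_mul_of_nonneg_left (by simpa using hle₁ i) hlam₀)
    (mul_le_mul_of_nonneg_left (by simpa using hle₂ i) hμ)
end
end

section
/- A CSP assignment Φ = (φ_1,…,φ_k) ∈ (Δ_{mn})^k corresponds to a valid no-regret menu iff three explicit finite-dimensional conditions hold. Precisely: there exists a closed convex set M ⊆ Δ_{mn} with M_NSR ⊆ M ⊆ M_NR such that for every i ∈ [k], φ_i ∈ M and u_{O,i}(φ_i) = sup_{φ ∈ M} u_{O,i}(φ), if and only if (1) φ_i ∈ M_NR for all i ∈ [k]; (2) u_{O,i}(φ_i) ≥ u_{O,i}(φ_{i'}) for all i, i' ∈ [k]; and (3) u_{O,i}(φ_i) ≥ u_{O,i}(ψ) for all i ∈ [k] and all ψ ∈ M_NSR. Moreover, when these conditions hold, M = conv(M_NSR ∪ {φ_1,…,φ_k}) is such a set. -/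
open scoped BigOperators

noncomputable section

/-- The set `M_NR` of no-regret CSPs for learner payoff `uL`. -/
def MNR {m n : ℕ} (uL : Fin m × Fin n → ℝ) : Set (Fin m × Fin n → ℝ) :=
  {φ ∈ stdSimplex ℝ (Fin m × Fin n) |
    ∀ istar : Fin m, (∑ p : Fin m × Fin n, φ p * uL (istar, p.2)) ≤ lin uL φ}

/-- The set `M_NSR` of no-swap-regret CSPs for learner payoff `uL`. -/
def MNSR {m n : ℕ} (uL : Fin m × Fin n → ℝ) : Set (Fin m × Fin n → ℝ) :=
  {φ ∈ stdSimplex ℝ (Fin m × Fin n) |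
    ∀ i istar : Fin m,
      (∑ j : Fin n, φ (i, j) * uL (istar, j)) ≤ ∑ j : Fin n, φ (i, j) * uL (i, j)}

theorem isLinearMap_lin {m n : ℕ} (u : Fin m × Fin n → ℝ) : IsLinearMap ℝ (lin u) where
  map_add x y := by simp [lin, add_mul, Finset.sum_add_distrib]
  map_smul c x := by simp [lin, mul_assoc, Finset.mul_sum]

theorem continuous_lin {m n : ℕ} (u : Fin m × Fin n → ℝ) : Continuous (lin u) := by
  unfold lin
  fun_prop

theorem convex_MNR {m n : ℕ} (uL : Fin m × Fin n → ℝ) : Convex ℝ (MNR uL) := by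
  have hMNR : MNR uL = stdSimplex ℝ (Fin m × Fin n) ∩
      ⋂ istar : Fin m, {φ | lin (fun p ↦ uL (istar, p.2) - uL p) φ ≤ 0} := by
    ext φ
    simp [MNR, lin, mul_sub, Finset.sum_sub_distrib]
  rw [hMNR]
  exact (convex_stdSimplex ℝ _).inter
    (convex_iInter fun _ ↦ convex_halfSpace_le (isLinearMap_lin _) 0)

theorem MNSR_subset_MNR {m n : ℕ} (uL : Fin m × Fin n → ℝ) : MNSR uL ⊆ MNR uL := by
  rintro φ ⟨hφ, h⟩
  refine ⟨hφ, fun istar ↦ ?_⟩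
  simp only [lin, Fintype.sum_prod_type]
  exact Finset.sum_le_sum fun i _ ↦ h i istar

theorem MNSR_eq_inter {m n : ℕ} (uL : Fin m × Fin n → ℝ) :
    MNSR uL = stdSimplex ℝ (Fin m × Fin n) ∩ ⋂ (i : Fin m) (istar : Fin m),
      {φ | ∑ j, φ (i, j) * (uL (istar, j) - uL (i, j)) ≤ 0} := by
  ext φ
  simp [MNSR, mul_sub, Finset.sum_sub_distrib]

theorem convex_MNSR {m n : ℕ} (uL : Fin m × Fin n → ℝ) : Convex ℝ (MNSR uL) := by
  rw [MNSR_eq_inter]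
  refine (convex_stdSimplex ℝ _).inter
    (convex_iInter fun i ↦ convex_iInter fun istar ↦ convex_halfSpace_le ⟨?_, ?_⟩ 0)
  · intro x y
    simp [add_mul, Finset.sum_add_distrib]
  · intro c x
    simp [mul_assoc, Finset.mul_sum]

theorem isCompact_MNSR {m n : ℕ} (uL : Fin m × Fin n → ℝ) : IsCompact (MNSR uL) := by
  rw [MNSR_eq_inter]
  exact (isCompact_stdSimplex ℝ (Fin m × Fin n)).inter_right <|
    isClosed_iInter fun i ↦ isClosed_iInter fun istar ↦
      isClosed_le (by fun_prop) continuous_const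

theorem IsCompact.convexJoin {E : Type*} [AddCommGroup E] [Module ℝ E] [TopologicalSpace E]
    [ContinuousAdd E] [ContinuousSMul ℝ E] {s t : Set E}
    (hs : IsCompact s) (ht : IsCompact t) : IsCompact (convexJoin ℝ s t) := by
  have himage : _root_.convexJoin ℝ s t =
      (fun p : E × E × ℝ ↦ (1 - p.2.2) • p.1 + p.2.2 • p.2.1) '' s ×ˢ t ×ˢ Set.Icc 0 1 := by
    ext x
    simp only [mem_convexJoin, segment_eq_image, Set.mem_image, Prod.exists, Set.mem_prod]
    grind
  rw [himage]
  exact (hs.prod (ht.prod isCompact_Icc)).image (by fun_prop)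

theorem isCompact_convexHull_MNSR_union_range {m n k : ℕ} (uL : Fin m × Fin n → ℝ)
    (Φ : Fin k → Fin m × Fin n → ℝ) : IsCompact (convexHull ℝ (MNSR uL ∪ Set.range Φ)) := by
  have hrange := (Set.finite_range Φ).isCompact_convexHull ℝ
  have hMNSR := (convex_MNSR uL).convexHull_eq
  rcases (MNSR uL).eq_empty_or_nonempty with h | h
  · simpa [h] using hrange
  rcases (Set.range Φ).eq_empty_or_nonempty with h' | h'
  · simpa [h', hMNSR] using isCompact_MNSR uL
  · rw [convexHull_union h h', hMNSR]
    exact (isCompact_MNSR uL).convexJoin hrange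

theorem bddAbove_lin_image {m n : ℕ} (u : Fin m × Fin n → ℝ) {M : Set (Fin m × Fin n → ℝ)}
    (hM : M ⊆ stdSimplex ℝ (Fin m × Fin n)) : BddAbove (lin u '' M) :=
  ((isCompact_stdSimplex ℝ (Fin m × Fin n)).bddAbove_image (continuous_lin u).continuousOn).mono
    (Set.image_mono hM)

theorem convexHull_isMenu {m n k : ℕ} (uL : Fin m × Fin n → ℝ)
    (uO : Fin k → Fin m × Fin n → ℝ) (Φ : Fin k → Fin m × Fin n → ℝ)
    (hNR : ∀ i, Φ i ∈ MNR uL)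
    (hIC : ∀ i i', lin (uO i) (Φ i') ≤ lin (uO i) (Φ i))
    (hNSR : ∀ i, ∀ ψ ∈ MNSR uL, lin (uO i) ψ ≤ lin (uO i) (Φ i)) :
    IsClosed (convexHull ℝ (MNSR uL ∪ Set.range Φ)) ∧
      Convex ℝ (convexHull ℝ (MNSR uL ∪ Set.range Φ)) ∧
      MNSR uL ⊆ convexHull ℝ (MNSR uL ∪ Set.range Φ) ∧
      convexHull ℝ (MNSR uL ∪ Set.range Φ) ⊆ MNR uL ∧
      ∀ i, Φ i ∈ convexHull ℝ (MNSR uL ∪ Set.range Φ) ∧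
        lin (uO i) (Φ i) = sSup (lin (uO i) '' convexHull ℝ (MNSR uL ∪ Set.range Φ)) := by
  have hmem : ∀ i, Φ i ∈ convexHull ℝ (MNSR uL ∪ Set.range Φ) := fun i ↦
    subset_convexHull ℝ _ (Or.inr ⟨i, rfl⟩)
  refine ⟨(isCompact_convexHull_MNSR_union_range uL Φ).isClosed,
    convex_convexHull ℝ _, Set.subset_union_left.trans (subset_convexHull ℝ _),
    convexHull_min (Set.union_subset (MNSR_subset_MNR uL) (Set.range_subset_iff.2 hNR))
      (convex_MNR uL), fun i ↦ ⟨hmem i, ?_⟩⟩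
  have hle : convexHull ℝ (MNSR uL ∪ Set.range Φ) ⊆ {φ | lin (uO i) φ ≤ lin (uO i) (Φ i)} :=
    convexHull_min (Set.union_subset (hNSR i) (Set.range_subset_iff.2 (hIC i)))
      (convex_halfSpace_le (isLinearMap_lin _) _)
  exact (IsGreatest.csSup_eq
    ⟨Set.mem_image_of_mem _ (hmem i), Set.forall_mem_image.2 fun _ h ↦ hle h⟩).symm

/-- `Φ` corresponds to a valid no-regret menu (a closed convex `M`
with `M_NSR ⊆ M ⊆ M_NR` in which each `φ_i` maximizes `u_{O,i}`) iff
(1) each `φ_i ∈ M_NR`, (2) each type prefers its own CSP to the others', and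
(3) each type prefers its own CSP to every no-swap-regret CSP. Moreover, in
that case `conv(M_NSR ∪ {φ_1,…,φ_k})` is such a set. -/
theorem noRegret_csp_assignment_characterization {m n k : ℕ}
    (hm : 0 < m) (hn : 0 < n) (hk : 0 < k)
    (uL : Fin m × Fin n → ℝ) (uO : Fin k → Fin m × Fin n → ℝ)
    (Φ : Fin k → Fin m × Fin n → ℝ)
    (hΦ : ∀ i, Φ i ∈ stdSimplex ℝ (Fin m × Fin n)) :
    ((∃ M : Set (Fin m × Fin n → ℝ),
        IsClosed M ∧ Convex ℝ M ∧ MNSR uL ⊆ M ∧ M ⊆ MNR uL ∧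
        ∀ i, Φ i ∈ M ∧ lin (uO i) (Φ i) = sSup (lin (uO i) '' M)) ↔
      ((∀ i, Φ i ∈ MNR uL) ∧
       (∀ i i', lin (uO i) (Φ i') ≤ lin (uO i) (Φ i)) ∧
       (∀ i, ∀ ψ ∈ MNSR uL, lin (uO i) ψ ≤ lin (uO i) (Φ i))))
    ∧ (((∀ i, Φ i ∈ MNR uL) ∧
        (∀ i i', lin (uO i) (Φ i') ≤ lin (uO i) (Φ i)) ∧
        (∀ i, ∀ ψ ∈ MNSR uL, lin (uO i) ψ ≤ lin (uO i) (Φ i))) →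
        (IsClosed (convexHull ℝ (MNSR uL ∪ Set.range Φ)) ∧
         Convex ℝ (convexHull ℝ (MNSR uL ∪ Set.range Φ)) ∧
         MNSR uL ⊆ convexHull ℝ (MNSR uL ∪ Set.range Φ) ∧
         convexHull ℝ (MNSR uL ∪ Set.range Φ) ⊆ MNR uL ∧
         ∀ i, Φ i ∈ convexHull ℝ (MNSR uL ∪ Set.range Φ) ∧
           lin (uO i) (Φ i) =
             sSup (lin (uO i) '' convexHull ℝ (MNSR uL ∪ Set.range Φ)))) := by
  refine ⟨⟨?_, fun ⟨h₁, h₂, h₃⟩ ↦ ⟨_, convexHull_isMenu uL uO Φ h₁ h₂ h₃⟩⟩,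
    fun ⟨h₁, h₂, h₃⟩ ↦ convexHull_isMenu uL uO Φ h₁ h₂ h₃⟩
  rintro ⟨M, -, -, hNSR, hNR, hM⟩
  have hmax : ∀ i, ∀ φ ∈ M, lin (uO i) φ ≤ lin (uO i) (Φ i) := fun i φ hφ ↦
    (le_csSup (bddAbove_lin_image _ fun _ h ↦ (hNR h).1)
      (Set.mem_image_of_mem _ hφ)).trans_eq (hM i).2.symm
  exact ⟨fun i ↦ hNR (hM i).1, fun i i' ↦ hmax i _ (hM i').1, fun i ψ hψ ↦ hmax i ψ (hNSR hψ)⟩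
end
end
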